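/- arXiv:1707.07349 — 4 statements merged into one kernel-verified Lean document; each statement's English description precedes it below -/
import Mathlib

section
/- Let φ : ℝⁿ × ℝᵐ → ℝ be C² and concave-convex with at least one saddle point, and let z(·) ∈ S. Then the average position lim_{T→∞} (1/T) ∫₀^T z(t) dt exists, and it is a saddle point of φ. -/
open scoped BigOperators

noncomputable section

/-- Points of `ℝⁿ × ℝᵐ`. -/
abbrev Pt (n m : ℕ) := (Fin n → ℝ) × (Fin m → ℝ)

variable {n m : ℕ}

/-- The Euclidean distance on `ℝⁿ × ℝᵐ`. -/
def eDist (a b : Pt n m) : ℝ :=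
  Real.sqrt (∑ i, (a.1 i - b.1 i) ^ 2 + ∑ j, (a.2 j - b.2 j) ^ 2)

/-- The Euclidean inner product on `ℝⁿ × ℝᵐ`. -/
def ip (a b : Pt n m) : ℝ := ∑ i, a.1 i * b.1 i + ∑ j, a.2 j * b.2 j

/-- `φ` is concave-convex: concave in `x` for each fixed `y`, convex in `y` for each fixed `x`. -/
def ConcaveConvex (φ : Pt n m → ℝ) : Prop :=
  (∀ y, ConcaveOn ℝ Set.univ fun x => φ (x, y)) ∧
    (∀ x, ConvexOn ℝ Set.univ fun y => φ (x, y))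

/-- `zb` is a saddle point of `φ`. -/
def IsSaddle (φ : Pt n m → ℝ) (zb : Pt n m) : Prop :=
  ∀ x y, φ (x, zb.2) ≤ φ zb ∧ φ zb ≤ φ (zb.1, y)

/-- The gradient of `φ` in the `x` variables. -/
def gradX (φ : Pt n m → ℝ) (z : Pt n m) : Fin n → ℝ :=
  fun i => fderiv ℝ φ z (Pi.single i 1, 0)

/-- The gradient of `φ` in the `y` variables. -/
def gradY (φ : Pt n m → ℝ) (z : Pt n m) : Fin m → ℝ :=
  fun j => fderiv ℝ φ z (0, Pi.single j 1)

/-- `z : ℝ → ℝⁿ × ℝᵐ` is a (global, C¹) solution of the gradient dynamics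
`ẋ = ∇ₓφ, ẏ = -∇_yφ`. -/
def IsSolution (φ : Pt n m → ℝ) (z : ℝ → Pt n m) : Prop :=
  ∀ t, HasDerivAt z (gradX φ (z t), -gradY φ (z t)) t

/-- `z ∈ 𝒮`: a solution of the gradient dynamics lying at constant distance
from every saddle point. -/
def InS (φ : Pt n m → ℝ) (z : ℝ → Pt n m) : Prop :=
  IsSolution φ z ∧ ∀ zb, IsSaddle φ zb → ∀ t, eDist (z t) zb = eDist (z 0) zb

/-- Second directional derivative of `φ` at `z`, in directions `u` then `v`. -/
def hess (φ : Pt n m → ℝ) (z u v : Pt n m) : ℝ :=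
  fderiv ℝ (fun w => fderiv ℝ φ w u) z v

/-- The `i`th coordinate direction in the `x` variables. -/
def ex (i : Fin n) : Pt n m := (Pi.single i 1, 0)

/-- The `j`th coordinate direction in the `y` variables. -/
def ey (j : Fin m) : Pt n m := (0, Pi.single j 1)

/-- The matrix `A(z) = [[0, φ_{xy}(z)], [-φ_{yx}(z), 0]]`. -/
def matA (φ : Pt n m → ℝ) (z : Pt n m) : Matrix (Fin n ⊕ Fin m) (Fin n ⊕ Fin m) ℝ :=
  Matrix.fromBlocks 0 (Matrix.of fun i j => hess φ z (ex i) (ey j))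
    (Matrix.of fun j i => -hess φ z (ey j) (ex i)) 0

/-- The matrix `B(z) = [[φ_{xx}(z), 0], [0, -φ_{yy}(z)]]`. -/
def matB (φ : Pt n m → ℝ) (z : Pt n m) : Matrix (Fin n ⊕ Fin m) (Fin n ⊕ Fin m) ℝ :=
  Matrix.fromBlocks (Matrix.of fun i i' => hess φ z (ex i) (ex i')) 0 0
    (Matrix.of fun j j' => -hess φ z (ey j) (ey j'))

/-- A point of `ℝⁿ × ℝᵐ` viewed as a vector indexed by `Fin n ⊕ Fin m`. -/
def vec (z : Pt n m) : Fin n ⊕ Fin m → ℝ := Sum.elim z.1 z.2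

/-- A vector indexed by `Fin n ⊕ Fin m` viewed as a point of `ℝⁿ × ℝᵐ`. -/
def unvec (v : Fin n ⊕ Fin m → ℝ) : Pt n m :=
  (fun i => v (Sum.inl i), fun j => v (Sum.inr j))

end

open Filter Topology MeasureTheory

/-- The gradient inequality for convex functions. -/
theorem ConvexOn.fderiv_sub_le {E : Type*} [NormedAddCommGroup E] [NormedSpace ℝ E]
    {f : E → ℝ} {f' : E →L[ℝ] ℝ} {x : E} (hf : ConvexOn ℝ Set.univ f)
    (hd : HasFDerivAt f f' x) (y : E) : f' (y - x) ≤ f y - f x := by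
  have hline : ConvexOn ℝ Set.univ (f ∘ AffineMap.lineMap (k := ℝ) x y) := by
    simpa using hf.comp_affineMap (AffineMap.lineMap (k := ℝ) x y)
  have hderiv : HasDerivAt (f ∘ AffineMap.lineMap (k := ℝ) x y) (f' (y - x)) 0 := by
    have h0 : HasFDerivAt f f' (AffineMap.lineMap (k := ℝ) x y (0 : ℝ)) := by simpa using hd
    exact h0.comp_hasDerivAt 0 AffineMap.hasDerivAt_lineMap
  have h := hline.le_slope_of_hasDerivAt (Set.mem_univ 0) (Set.mem_univ 1) one_pos hderiv
  simpa [slope_def_field] using h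

theorem ConcaveOn.sub_le_fderiv_sub {E : Type*} [NormedAddCommGroup E] [NormedSpace ℝ E]
    {f : E → ℝ} {f' : E →L[ℝ] ℝ} {x : E} (hf : ConcaveOn ℝ Set.univ f)
    (hd : HasFDerivAt f f' x) (y : E) : f y - f x ≤ f' (y - x) := by
  have h := ConvexOn.fderiv_sub_le (f := -f) hf.neg hd.neg y
  simp only [neg_apply, Pi.neg_apply] at h
  linarith

theorem fderiv_fst_eq_sum_gradX {n m : ℕ} (φ : Pt n m → ℝ) (z : Pt n m) (v : Fin n → ℝ) :
    fderiv ℝ φ z (v, 0) = ∑ i, gradX φ z i * v i := by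
  have h := LinearMap.pi_apply_eq_sum_univ
    ((fderiv ℝ φ z).comp (ContinuousLinearMap.inl ℝ (Fin n → ℝ) (Fin m → ℝ))).toLinearMap v
  simp only [ContinuousLinearMap.coe_coe, ContinuousLinearMap.comp_apply,
    ContinuousLinearMap.inl_apply, smul_eq_mul] at h
  rw [h]
  refine Finset.sum_congr rfl fun i _ => ?_
  rw [mul_comm, gradX]
  congr 3
  ext j
  simp [Pi.single_apply, eq_comm]

theorem fderiv_snd_eq_sum_gradY {n m : ℕ} (φ : Pt n m → ℝ) (z : Pt n m) (v : Fin m → ℝ) :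
    fderiv ℝ φ z (0, v) = ∑ j, gradY φ z j * v j := by
  have h := LinearMap.pi_apply_eq_sum_univ
    ((fderiv ℝ φ z).comp (ContinuousLinearMap.inr ℝ (Fin n → ℝ) (Fin m → ℝ))).toLinearMap v
  simp only [ContinuousLinearMap.coe_coe, ContinuousLinearMap.comp_apply,
    ContinuousLinearMap.inr_apply, smul_eq_mul] at h
  rw [h]
  refine Finset.sum_congr rfl fun i _ => ?_
  rw [mul_comm, gradY]
  congr 3
  ext j
  simp [Pi.single_apply, eq_comm]

/-- The monotonicity of the gradient dynamics: the velocity field at `z`, paired with `z - u`. -/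
theorem ip_velocity_sub_le {n m : ℕ} {φ : Pt n m → ℝ} (hφ : Differentiable ℝ φ)
    (hcc : ConcaveConvex φ) (z u : Pt n m) :
    ip (gradX φ z, -gradY φ z) (z - u) ≤ φ (z.1, u.2) - φ (u.1, z.2) := by
  have hx := (hcc.1 z.2).sub_le_fderiv_sub
    ((hφ z).hasFDerivAt.comp z.1 (hasFDerivAt_prodMk_left z.1 z.2)) u.1
  have hy := (hcc.2 z.1).fderiv_sub_le
    ((hφ z).hasFDerivAt.comp z.2 (hasFDerivAt_prodMk_right z.1 z.2)) u.2
  simp only [ContinuousLinearMap.comp_apply, ContinuousLinearMap.inl_apply,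
    ContinuousLinearMap.inr_apply, fderiv_fst_eq_sum_gradX, fderiv_snd_eq_sum_gradY,
    Pi.sub_apply, mul_sub, Finset.sum_sub_distrib] at hx hy
  simp only [ip, Prod.fst_sub, Prod.snd_sub, Pi.sub_apply, Pi.neg_apply, mul_sub, neg_mul,
    Finset.sum_sub_distrib, Finset.sum_neg_distrib]
  linarith

theorem eDist_sq {n m : ℕ} (a b : Pt n m) : eDist a b ^ 2 = ip (a - b) (a - b) := by
  rw [eDist, Real.sq_sqrt (by positivity)]
  simp [ip, sq]

theorem norm_sub_le_eDist {n m : ℕ} (a b : Pt n m) : ‖a - b‖ ≤ eDist a b := by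
  have key : ∀ c : ℝ, c ^ 2 ≤ ∑ i, (a.1 i - b.1 i) ^ 2 + ∑ j, (a.2 j - b.2 j) ^ 2 →
      ‖c‖ ≤ eDist a b := fun c hc => Real.abs_le_sqrt hc
  have h0 : 0 ≤ eDist a b := Real.sqrt_nonneg _
  refine max_le ((pi_norm_le_iff_of_nonneg h0).2 fun i => key _ ?_)
    ((pi_norm_le_iff_of_nonneg h0).2 fun j => key _ ?_)
  · have := Finset.single_le_sum (f := fun i => (a.1 i - b.1 i) ^ 2)
      (fun i _ => sq_nonneg _) (Finset.mem_univ i)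
    exact this.trans (le_add_of_nonneg_right (by positivity))
  · have := Finset.single_le_sum (f := fun j => (a.2 j - b.2 j) ^ 2)
      (fun i _ => sq_nonneg _) (Finset.mem_univ j)
    exact this.trans (le_add_of_nonneg_left (by positivity))

theorem ip_sub_right_eq {n m : ℕ} (z a b : Pt n m) :
    ip z (a - b) = (eDist z b ^ 2 - eDist z a ^ 2 + ip a a - ip b b) / 2 := by
  simp only [eDist_sq, ip, Prod.fst_sub, Prod.snd_sub, Pi.sub_apply, mul_sub, sub_mul,
    Finset.sum_sub_distrib]
  simp only [mul_comm (a.1 _) (z.1 _), mul_comm (b.1 _) (z.1 _), mul_comm (a.2 _) (z.2 _),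
    mul_comm (b.2 _) (z.2 _)]
  ring

theorem HasDerivAt.ip_sub_self {n m : ℕ} {z : ℝ → Pt n m} {v : Pt n m} {t : ℝ}
    (hz : HasDerivAt z v t) (u : Pt n m) :
    HasDerivAt (fun s => ip (z s - u) (z s - u)) (2 * ip v (z t - u)) t := by
  have h := hz.sub_const u
  have h1 := fun i => hasDerivAt_pi.1 h.fst i
  have h2 := fun j => hasDerivAt_pi.1 h.snd j
  have := (HasDerivAt.fun_sum (u := Finset.univ) fun i _ => (h1 i).mul (h1 i)).add
    (HasDerivAt.fun_sum (u := Finset.univ) fun j _ => (h2 j).mul (h2 j))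
  refine this.congr_deriv ?_
  simp only [ip, mul_add, Finset.mul_sum]
  congr 1 <;> exact Finset.sum_congr rfl fun i _ => by ring

/-- The time average of `z` over `[0, T]`. -/
noncomputable def timeAverage {n m : ℕ} (z : ℝ → Pt n m) (T : ℝ) : Pt n m :=
  (1 / T) • ∫ t in (0 : ℝ)..T, z t

/-- Jensen's inequality for time averages. -/
theorem ConcaveOn.integral_le_timeAverage {n m : ℕ} {g : Pt n m → ℝ}
    (hg : ConcaveOn ℝ Set.univ g) (hgc : Continuous g) {z : ℝ → Pt n m} (hz : Continuous z)
    {T : ℝ} (hT : 0 < T) : (1 / T) * ∫ t in (0 : ℝ)..T, g (z t) ≤ g (timeAverage z T) := by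
  have h := hg.le_map_set_average (μ := volume) (t := Set.uIoc 0 T) (f := z)
    hgc.continuousOn isClosed_univ (by simp [Set.uIoc_of_le hT.le, hT]) (by simp)
    (by simp) (hz.integrableOn_uIoc) ((hgc.comp hz).integrableOn_uIoc)
  rw [interval_average_eq, interval_average_eq] at h
  simpa [timeAverage] using h

theorem neg_le_timeAverage_gap {n m : ℕ} {φ : Pt n m → ℝ} (hφ : Differentiable ℝ φ)
    (hcc : ConcaveConvex φ) {z : ℝ → Pt n m} (hz : IsSolution φ z) (u : Pt n m)
    {T : ℝ} (hT : 0 < T) :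
    -(ip (z 0 - u) (z 0 - u) / 2 / T) ≤
      φ ((timeAverage z T).1, u.2) - φ (u.1, (timeAverage z T).2) := by
  have hzc : Continuous z := continuous_iff_continuousAt.2 fun t => (hz t).continuousAt
  have hgc : Continuous fun w : Pt n m => φ (w.1, u.2) - φ (u.1, w.2) := by
    have := hφ.continuous
    fun_prop
  have hg : ConcaveOn ℝ Set.univ fun w : Pt n m => φ (w.1, u.2) - φ (u.1, w.2) :=
    ((hcc.1 u.2).comp_linearMap (LinearMap.fst ℝ (Fin n → ℝ) (Fin m → ℝ))).sub
      ((hcc.2 u.1).comp_linearMap (LinearMap.snd ℝ (Fin n → ℝ) (Fin m → ℝ)))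
  have hd : ∀ t, HasDerivAt (fun s => ip (z s - u) (z s - u) / 2)
      (ip (gradX φ (z t), -gradY φ (z t)) (z t - u)) t := fun t =>
    (((hz t).ip_sub_self u).div_const 2).congr_deriv (by ring)
  have hint := intervalIntegral.sub_le_integral_of_hasDeriv_right_of_le hT.le
    (fun t _ => (hd t).continuousAt.continuousWithinAt) (fun t _ => (hd t).hasDerivWithinAt)
    (hgc.comp hzc).continuousOn.integrableOn_Icc
    (fun t _ => ip_velocity_sub_le hφ hcc (z t) u)
  have hnn : 0 ≤ ip (z T - u) (z T - u) := by
    rw [← eDist_sq]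
    positivity
  refine le_trans ?_ (hg.integral_le_timeAverage hgc hzc hT)
  rw [← neg_div, div_eq_mul_one_div, mul_comm]
  refine mul_le_mul_of_nonneg_left (le_trans ?_ hint) (by positivity)
  linarith

theorem isSaddle_of_tendsto_timeAverage {n m : ℕ} {φ : Pt n m → ℝ} (hφ : Differentiable ℝ φ)
    (hcc : ConcaveConvex φ) {z : ℝ → Pt n m} (hz : IsSolution φ z) {l : Filter ℝ} [l.NeBot]
    (hl : l ≤ atTop) {w : Pt n m} (hw : Tendsto (timeAverage z) l (𝓝 w)) : IsSaddle φ w := by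
  have key : ∀ u : Pt n m, 0 ≤ φ (w.1, u.2) - φ (u.1, w.2) := fun u => by
    have hgc : Continuous fun w : Pt n m => φ (w.1, u.2) - φ (u.1, w.2) := by
      have := hφ.continuous
      fun_prop
    have hlim : Tendsto (fun T : ℝ => -(ip (z 0 - u) (z 0 - u) / 2 / T)) l (𝓝 0) := by
      simpa using (tendsto_id.const_div_atTop (ip (z 0 - u) (z 0 - u) / 2)).neg.mono_left hl
    refine le_of_tendsto_of_tendsto hlim ((hgc.tendsto w).comp hw) ?_
    filter_upwards [hl (eventually_gt_atTop 0)] with T hT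
    exact neg_le_timeAverage_gap hφ hcc hz u hT
  exact fun x y => ⟨sub_nonneg.1 (key (x, w.2)), sub_nonneg.1 (key (w.1, y))⟩

theorem norm_timeAverage_le {n m : ℕ} {z : ℝ → Pt n m} {C : ℝ} (hC : ∀ t, ‖z t‖ ≤ C) {T : ℝ}
    (hT : 0 < T) : ‖timeAverage z T‖ ≤ C := by
  have h := intervalIntegral.norm_integral_le_of_norm_le_const (a := 0) (b := T)
    (f := z) (C := C) fun t _ => hC t
  rw [sub_zero, abs_of_pos hT] at h
  rw [timeAverage, norm_smul, Real.norm_of_nonneg (by positivity), one_div,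
    inv_mul_le_iff₀ hT, mul_comm]
  exact h

theorem ip_timeAverage {n m : ℕ} {z : ℝ → Pt n m} (hz : Continuous z) {d : Pt n m} {c : ℝ}
    (hc : ∀ t, ip (z t) d = c) {T : ℝ} (hT : 0 < T) : ip (timeAverage z T) d = c := by
  let L : Pt n m →L[ℝ] ℝ := LinearMap.toContinuousLinearMap
    { toFun := fun a => ip a d
      map_add' := fun a b => by
        simp only [ip, Prod.fst_add, Prod.snd_add, Pi.add_apply, add_mul, Finset.sum_add_distrib]
        ring
      map_smul' := fun r a => by
        simp only [ip, Prod.smul_fst, Prod.smul_snd, Pi.smul_apply, smul_eq_mul, mul_add,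
          Finset.mul_sum, mul_assoc, RingHom.id_apply] }
  have hL : ∀ a, L a = ip a d := fun a => rfl
  rw [← hL, timeAverage, map_smul, ← L.intervalIntegral_comp_comm (hz.intervalIntegrable 0 T)]
  simp only [hL, hc, intervalIntegral.integral_const, smul_eq_mul]
  field_simp
  ring

theorem continuous_ip_left {n m : ℕ} (d : Pt n m) : Continuous fun a : Pt n m => ip a d := by
  unfold ip
  fun_prop

theorem eq_of_ip_sub_eq {n m : ℕ} {a b : Pt n m} (h : ip a (a - b) = ip b (a - b)) : a = b := by
  have h0 : eDist a b ^ 2 = 0 := by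
    rw [eDist_sq]
    simp only [ip, Prod.fst_sub, Prod.snd_sub, Pi.sub_apply, sub_mul,
      Finset.sum_sub_distrib] at h ⊢
    linarith
  have h1 := norm_sub_le_eDist a b
  rw [pow_eq_zero_iff two_ne_zero] at h0
  rw [h0] at h1
  exact sub_eq_zero.1 (norm_le_zero_iff.1 h1)

/-- The time-average of any trajectory in `𝒮` converges, and its limit is
a saddle point of `φ`. -/
theorem average_of_S_is_saddle {n m : ℕ} (φ : Pt n m → ℝ)
    (hφ : ContDiff ℝ 2 φ) (hcc : ConcaveConvex φ)
    (hsaddle : ∃ zb, IsSaddle φ zb)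
    (z : ℝ → Pt n m) (hz : InS φ z) :
    ∃ w : Pt n m,
      Filter.Tendsto (fun T : ℝ => (1 / T) • ∫ t in (0 : ℝ)..T, z t)
        Filter.atTop (nhds w) ∧ IsSaddle φ w := by
  obtain ⟨zb, hzb⟩ := hsaddle
  obtain ⟨hsol, hdist⟩ := hz
  have hd : Differentiable ℝ φ := hφ.differentiable two_ne_zero
  have hzc : Continuous z := continuous_iff_continuousAt.2 fun t => (hsol t).continuousAt
  have hbound : ∀ t, ‖z t‖ ≤ eDist (z 0) zb + ‖zb‖ := fun t => by
    have h1 := norm_sub_le_eDist (z t) zb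
    rw [hdist zb hzb t] at h1
    linarith [norm_le_norm_sub_add (z t) zb]
  have hmem : ∀ᶠ T in atTop,
      timeAverage z T ∈ Metric.closedBall (0 : Pt n m) (eDist (z 0) zb + ‖zb‖) := by
    filter_upwards [eventually_gt_atTop 0] with T hT
    simpa using norm_timeAverage_le hbound hT
  have hK := isCompact_closedBall (0 : Pt n m) (eDist (z 0) zb + ‖zb‖)
  have hsad : ∀ w, MapClusterPt w atTop (timeAverage z) → IsSaddle φ w := fun w hw => by
    obtain ⟨U, hU, hUw⟩ := mapClusterPt_iff_ultrafilter.1 hw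
    exact isSaddle_of_tendsto_timeAverage hd hcc hsol hU hUw
  obtain ⟨w, -, hw⟩ := hK.exists_mapClusterPt_of_frequently hmem.frequently
  refine ⟨w, hK.tendsto_nhds_of_unique_mapClusterPt hmem fun v _ hv => ?_, hsad w hw⟩
  have hconst : ∀ t, ip (z t) (v - w) = ip (z 0) (v - w) := fun t => by
    rw [ip_sub_right_eq, ip_sub_right_eq, hdist v (hsad v hv) t, hdist w (hsad w hw) t]
  have hip : ∀ a, MapClusterPt a atTop (timeAverage z) →
      ip a (v - w) = ip (z 0) (v - w) := fun a ha => by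
    obtain ⟨U, hU, hUa⟩ := mapClusterPt_iff_ultrafilter.1 ha
    refine tendsto_nhds_unique (((continuous_ip_left (v - w)).tendsto a).comp hUa)
      (tendsto_const_nhds.congr' ?_)
    filter_upwards [hU (eventually_gt_atTop 0)] with T hT
    exact (ip_timeAverage hzc hconst hT).symm
  exact eq_of_ip_sub_eq ((hip v hv).trans (hip w hw).symm)
end

section
/- Let A be a normal matrix acting on ℂⁿ and X a linear subspace of ℂⁿ. Let Y = span{v ∈ X : v is an eigenvector of A}. Then Y is invariant under A, Y ⊆ X, and every subspace of X that is invariant under A is contained in Y; i.e. Y is the largest A-invariant subspace contained in X. -/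
open scoped ComplexOrder in
/-- A normal matrix and its square have the same kernel. -/
theorem Matrix.mulVec_eq_zero_of_mulVec_mulVec_eq_zero {n : Type*} [Fintype n]
    {B : Matrix n n ℂ} (hB : B * B.conjTranspose = B.conjTranspose * B) {v : n → ℂ}
    (h : B.mulVec (B.mulVec v) = 0) : B.mulVec v = 0 := by
  have hH : (B.conjTranspose * B).conjTranspose * (B.conjTranspose * B) =
      B.conjTranspose * B.conjTranspose * (B * B) := by
    rw [Matrix.conjTranspose_mul, Matrix.conjTranspose_conjTranspose, Matrix.mul_assoc,
      ← Matrix.mul_assoc B, hB]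
    simp only [Matrix.mul_assoc]
  rw [← Matrix.conjTranspose_mul_self_mulVec_eq_zero,
    ← Matrix.conjTranspose_mul_self_mulVec_eq_zero, hH]
  simp only [← Matrix.mulVec_mulVec, h, Matrix.mulVec_zero]

/-- Generalized eigenvectors of a normal matrix are eigenvectors. -/
theorem Matrix.mulVec_eq_smul_of_mem_maxGenEigenspace {n : Type*} [Fintype n] [DecidableEq n]
    {A : Matrix n n ℂ} (hA : A * A.conjTranspose = A.conjTranspose * A) {μ : ℂ} {v : n → ℂ}
    (hv : v ∈ Module.End.maxGenEigenspace (Matrix.toLin' A) μ) : A.mulVec v = μ • v := by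
  have hB : (A - μ • 1) * (A - μ • 1).conjTranspose =
      (A - μ • 1).conjTranspose * (A - μ • 1) := by
    simp only [Matrix.conjTranspose_sub, Matrix.conjTranspose_smul, Matrix.conjTranspose_one,
      sub_mul, mul_sub, smul_mul_assoc, mul_smul_comm, one_mul, mul_one, hA, smul_sub, smul_comm μ (star μ)]
    abel
  have hlin : Matrix.toLin' A - μ • 1 = Matrix.toLin' (A - μ • 1) := by
    rw [map_sub, map_smul, Matrix.toLin'_one]
    rfl
  obtain ⟨m, hm⟩ := (Module.End.mem_maxGenEigenspace _ _ _).1 hv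
  rw [hlin] at hm
  have key : ∀ m : ℕ, (Matrix.toLin' (A - μ • 1) ^ m) v = 0 → (A - μ • 1).mulVec v = 0 := by
    intro m
    induction m with
    | zero =>
      intro h
      have h0 : v = 0 := h
      rw [h0, Matrix.mulVec_zero]
    | succ m ih =>
      intro h
      cases m with
      | zero => rwa [zero_add, pow_one, Matrix.toLin'_apply] at h
      | succ m =>
        apply ih
        rw [pow_succ', Module.End.mul_apply, pow_succ', Module.End.mul_apply] at h
        rw [pow_succ', Module.End.mul_apply]
        exact Matrix.mulVec_eq_zero_of_mulVec_mulVec_eq_zero hB h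
  have h := key m hm
  rwa [Matrix.sub_mulVec, Matrix.smul_mulVec, Matrix.one_mulVec, sub_eq_zero] at h

/-- For a normal matrix `A` on `ℂⁿ` and a linear subspace `X ⊆ ℂⁿ`, the
span `Y` of the eigenvectors of `A` lying in `X` is the largest `A`-invariant subspace
contained in `X`. -/
theorem largest_invariant_subspace {k : ℕ} (A : Matrix (Fin k) (Fin k) ℂ)
    (hA : A * A.conjTranspose = A.conjTranspose * A)
    (X : Submodule ℂ (Fin k → ℂ))
    (Y : Submodule ℂ (Fin k → ℂ))
    (hY : Y = Submodule.span ℂ {v : Fin k → ℂ | v ∈ X ∧ v ≠ 0 ∧ ∃ μ : ℂ, A.mulVec v = μ • v}) :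
    (∀ v ∈ Y, A.mulVec v ∈ Y) ∧ Y ≤ X ∧
      ∀ W : Submodule ℂ (Fin k → ℂ), W ≤ X → (∀ v ∈ W, A.mulVec v ∈ W) → W ≤ Y := by
  subst hY
  refine ⟨fun v hv => ?_, Submodule.span_le.2 fun v hv => hv.1, fun W hWX hW => ?_⟩
  · induction hv using Submodule.span_induction with
    | mem x hx =>
      obtain ⟨μ, hμ⟩ := hx.2.2
      rw [hμ]
      exact Submodule.smul_mem _ _ (Submodule.subset_span hx)
    | zero => simp
    | add x y _ _ hx hy =>
      rw [Matrix.mulVec_add]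
      exact Submodule.add_mem _ hx hy
    | smul a x _ hx =>
      rw [Matrix.mulVec_smul]
      exact Submodule.smul_mem _ _ hx
  · have hdec : W = ⨆ μ, W ⊓ Module.End.maxGenEigenspace (Matrix.toLin' A) μ := by
      have h := Submodule.inf_iSup_genEigenspace (p := W) (f := Matrix.toLin' A) (k := ⊤)
        fun v hv => hW v hv
      have htop := Module.End.iSup_maxGenEigenspace_eq_top (Matrix.toLin' A)
      simp only [Module.End.maxGenEigenspace] at htop ⊢
      rwa [htop, inf_top_eq] at h
    rw [hdec]
    refine iSup_le fun μ v hv => ?_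
    by_cases h0 : v = 0
    · rw [h0]
      exact Submodule.zero_mem _
    · exact Submodule.subset_span
        ⟨hWX hv.1, h0, μ, Matrix.mulVec_eq_smul_of_mem_maxGenEigenspace hA hv.2⟩
end

section
/- Let U : ℝⁿ → ℝ be real-analytic and concave with U(0) = 0 and ∇U(0) = 0 (so 0 is a global maximizer and U ≤ 0). Then U⁻¹({0}) is a linear subspace of ℝⁿ: U⁻¹({0}) = span(U⁻¹({0})). -/
open Set Filter Topology in
/-- An analytic function on the line that vanishes on `[0, 1]` vanishes everywhere. -/
theorem AnalyticOnNhd.eq_zero_of_eqOn_Icc {f : ℝ → ℝ} (hf : AnalyticOnNhd ℝ f univ)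
    (h : ∀ t ∈ Icc (0 : ℝ) 1, f t = 0) (t : ℝ) : f t = 0 := by
  have hev : f =ᶠ[𝓝 (1 / 2)] fun _ => 0 := by
    filter_upwards [Icc_mem_nhds (show (0 : ℝ) < 1 / 2 by norm_num)
      (show (1 / 2 : ℝ) < 1 by norm_num)] with s hs using h s hs
  exact congrFun (hf.eq_of_eventuallyEq analyticOnNhd_const hev) t

section

variable {E : Type*} [NormedAddCommGroup E] [NormedSpace ℝ E] {U : E → ℝ}

/-- A critical point at `0` of a concave function is a global maximizer. -/
theorem ConcaveOn.le_of_fderiv_zero_eq_zero (hU : ConcaveOn ℝ Set.univ U)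
    (hd : DifferentiableAt ℝ U 0) (hd0 : fderiv ℝ U 0 = 0) (x : E) : U x ≤ U 0 := by
  have hg : ConcaveOn ℝ Set.univ fun t : ℝ => U (t • x) :=
    hU.comp_linearMap (LinearMap.toSpanSingleton ℝ E x)
  have hderiv : HasDerivAt (fun t : ℝ => U (t • x)) 0 0 := by
    have h1 : HasDerivAt (fun t : ℝ => t • x) x 0 := by
      simpa using (hasDerivAt_id (0 : ℝ)).smul_const x
    have h2 : HasFDerivAt U (0 : E →L[ℝ] ℝ) ((0 : ℝ) • x) := by
      simpa [hd0] using hd.hasFDerivAt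
    simpa [Function.comp_def] using h2.comp_hasDerivAt (0 : ℝ) h1
  have := hg.slope_le_of_hasDerivAt (Set.mem_univ 0) (Set.mem_univ 1) one_pos hderiv
  simpa [slope_def_field] using this

/-- The zero set of an analytic concave function is stable under scalar multiplication,
provided that `0` is a zero and a global maximizer. -/
theorem ConcaveOn.apply_smul_eq_zero_of_analytic (hU : ConcaveOn ℝ Set.univ U)
    (han : ∀ x, AnalyticAt ℝ U x) (h0 : U 0 = 0) (hle : ∀ x, U x ≤ 0) {x : E} (hx : U x = 0)
    (t : ℝ) : U (t • x) = 0 := by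
  refine AnalyticOnNhd.eq_zero_of_eqOn_Icc (f := fun s : ℝ => U (s • x)) (fun s _ => ?_)
    (fun s hs => (hle _).antisymm ?_) t
  · exact AnalyticAt.comp (f := fun r : ℝ => r • x) (han (s • x))
      (analyticAt_id.smul analyticAt_const)
  · simpa [h0, hx] using hU.2 (Set.mem_univ 0) (Set.mem_univ x) (sub_nonneg.2 hs.2) hs.1
      (sub_add_cancel 1 s)

end

/-- If `U : ℝⁿ → ℝ` is real-analytic and concave with `U(0) = 0` and
`∇U(0) = 0`, then its zero set (the set of its maximizers) is a linear subspace: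
`U⁻¹({0}) = span(U⁻¹({0}))`. -/
theorem zero_set_of_analytic_concave_is_subspace {n : ℕ}
    (U : (Fin n → ℝ) → ℝ) (hUan : ∀ x, AnalyticAt ℝ U x)
    (hUconc : ConcaveOn ℝ Set.univ U)
    (hU0 : U 0 = 0) (hdU0 : fderiv ℝ U 0 = 0) :
    U ⁻¹' {0} = (Submodule.span ℝ (U ⁻¹' {0}) : Set ((Fin n) → ℝ)) := by
  have hle : ∀ x, U x ≤ 0 := fun x =>
    hU0 ▸ hUconc.le_of_fderiv_zero_eq_zero (hUan 0).differentiableAt hdU0 x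
  have hsmul : ∀ (t : ℝ) {x}, U x = 0 → U (t • x) = 0 := fun t _ hx =>
    hUconc.apply_smul_eq_zero_of_analytic hUan hU0 hle hx t
  refine Set.Subset.antisymm Submodule.subset_span fun x hx => ?_
  induction hx using Submodule.span_induction with
  | mem x hx => exact hx
  | zero => exact hU0
  | add x y _ _ hx hy =>
    have hmid : U ((1 / 2 : ℝ) • x + (1 / 2 : ℝ) • y) = 0 := by
      refine (hle _).antisymm ?_
      have := hUconc.2 (Set.mem_univ x) (Set.mem_univ y) (show (0 : ℝ) ≤ 1 / 2 by norm_num)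
        (show (0 : ℝ) ≤ 1 / 2 by norm_num) (by norm_num)
      rwa [show U x = 0 from hx, show U y = 0 from hy, smul_zero, add_zero] at this
    have := hsmul 2 hmid
    rwa [smul_add, smul_smul, smul_smul, mul_one_div_cancel two_ne_zero, one_smul, one_smul]
      at this
  | smul t x _ hx => exact hsmul t hx
end

section
/- Let U′ : ℝⁿ → ℝ be real-analytic and concave, g′ : ℝⁿ → ℝᵐ affine, and let (x̄′, ȳ′) be a saddle point of φ(x′,y′) = U′(x′) + y′ᵀ·g′(x′). Define U(x) = U′(x + x̄′) + ȳ′ᵀ·g′(x + x̄′) − (U′(x̄′) + ȳ′ᵀ·g′(x̄′)) (so that U(0) = 0). Then U⁻¹({0}) = {x ∈ ℝⁿ : the map s ↦ U′(s·x + x̄′) is an affine function of s ∈ ℝ}. -/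
open scoped BigOperators

/-- Let `U'` be real-analytic and concave, `g'` affine, and `(x̄', ȳ')` a
saddle point of `φ(x',y') = U'(x') + y'ᵀ g'(x')`. With
`U(x) = U'(x + x̄') + ȳ'ᵀ g'(x + x̄') - (U'(x̄') + ȳ'ᵀ g'(x̄'))`, the zero set of `U` is the
set of directions along which `U'` is affine through `x̄'`. -/
theorem U_zero_set_eq_affine_directions {n m : ℕ}
    (U' : (Fin n → ℝ) → ℝ) (hU'an : ∀ x, AnalyticAt ℝ U' x)
    (hU'conc : ConcaveOn ℝ Set.univ U')
    (g' : (Fin n → ℝ) → Fin m → ℝ)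
    (hg' : ∃ (D : Matrix (Fin m) (Fin n) ℝ) (e : Fin m → ℝ), ∀ x, g' x = D.mulVec x + e)
    (xb : Fin n → ℝ) (yb : Fin m → ℝ)
    (hsaddle : IsSaddle (fun z : Pt n m => U' z.1 + ∑ j, z.2 j * g' z.1 j) (xb, yb))
    (U : (Fin n → ℝ) → ℝ)
    (hU : ∀ x, U x = U' (x + xb) + ∑ j, yb j * g' (x + xb) j
      - (U' xb + ∑ j, yb j * g' xb j)) :
    U ⁻¹' {0} = {x : Fin n → ℝ | ∃ c d : ℝ, ∀ s : ℝ, U' (s • x + xb) = c * s + d} := by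
  obtain ⟨D, e, hg⟩ := hg'
  have hline : ∀ x : Fin n → ℝ, ∃ k : ℝ, ∀ s : ℝ,
      U (s • x) = U' (s • x + xb) - U' xb + s * k := by
    intro x
    refine ⟨∑ j, yb j * D.mulVec x j, fun s => ?_⟩
    have hsum : ∑ j, yb j * g' (s • x + xb) j
        = s * ∑ j, yb j * D.mulVec x j + ∑ j, yb j * g' xb j := by
      rw [Finset.mul_sum, ← Finset.sum_add_distrib]
      refine Finset.sum_congr rfl fun j _ => ?_
      simp only [hg, Matrix.mulVec_add, Matrix.mulVec_smul, Pi.add_apply, Pi.smul_apply,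
        smul_eq_mul]
      ring
    rw [hU, hsum]
    ring
  have hU_nonpos : ∀ x, U x ≤ 0 := by
    intro x
    have h := (hsaddle (x + xb) yb).1
    simp only at h
    rw [hU]
    linarith
  ext x
  obtain ⟨k, hk⟩ := hline x
  simp only [Set.mem_preimage, Set.mem_singleton_iff, Set.mem_ofPred_eq]
  constructor
  · intro hx
    have hx1 := hk 1
    rw [one_smul, hx] at hx1
    have hzero : ∀ s ∈ Set.Ioo (0 : ℝ) 1, U' (s • x + xb) - U' xb + s * k = 0 := by
      intro s hs
      have hle := hU_nonpos (s • x)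
      rw [hk] at hle
      have hconc := hU'conc.2 (Set.mem_univ (x + xb)) (Set.mem_univ xb) hs.1.le
        (sub_nonneg.2 hs.2.le) (add_sub_cancel s 1)
      have hpt : s • (x + xb) + (1 - s) • xb = s • x + xb := by module
      rw [hpt, smul_eq_mul, smul_eq_mul] at hconc
      have hval : U' (x + xb) = U' xb - k := by linarith
      rw [hval] at hconc
      linarith
    have han : AnalyticOnNhd ℝ (fun s : ℝ => U' (s • x + xb) - U' xb + s * k) Set.univ := by
      intro s _
      have hpath : AnalyticAt ℝ (fun s : ℝ => s • x + xb) s :=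
        (analyticAt_id.smul analyticAt_const).add analyticAt_const
      exact ((AnalyticAt.fun_comp (g := U') (f := fun s : ℝ => s • x + xb) (hU'an _)
        hpath).sub analyticAt_const).add (analyticAt_id.mul analyticAt_const)
    have hfun := han.eq_of_eventuallyEq (analyticOnNhd_const (v := (0 : ℝ)))
      (Filter.eventually_of_mem
        (Ioo_mem_nhds (by norm_num : (0 : ℝ) < 1 / 2) (by norm_num : (1 / 2 : ℝ) < 1)) hzero)
    refine ⟨-k, U' xb, fun s => ?_⟩
    have hs := congrFun hfun s
    linarith
  · rintro ⟨c, d, hcd⟩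
    have h0 : U' xb = d := by simpa using hcd 0
    have hval : ∀ s : ℝ, U (s • x) = s * (c + k) := by
      intro s
      rw [hk, hcd, h0]
      ring
    have hpos := hU_nonpos ((1 : ℝ) • x)
    have hneg := hU_nonpos ((-1 : ℝ) • x)
    have hone := hval 1
    rw [hval] at hpos hneg
    rw [one_smul] at hone
    linarith
end
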